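/- Let G be a connected P4-free simple graph and let S be a cutset of G such that each vertex in S is adjacent to vertices of at least two distinct connected components of G − S. Suppose S is not a minimal cutset of G. Then there exist a cutset U ⊆ S of G, a nonempty set X ⊆ S − U, and a nonempty set Y ⊆ V(G) − S such that: (a) the induced subgraph G[X ∪ Y] is a connected component of G − U; and (b) every vertex of U is adjacent to every vertex of X ∪ Y, and every vertex of X is adjacent to every vertex of Y (i.e., the tripartite subgraph of G on parts U, X, Y is complete tripartite). -/

import Mathlib

open SimpleGraph

variable {V : Type*} {W : Type*}

/-- A graph is `P₄`-free if it contains no induced subgraph isomorphic to the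
path on four vertices. -/
def P4Free (G : SimpleGraph V) : Prop := IsEmpty (SimpleGraph.pathGraph 4 ↪g G)

/-- `R` is (the vertex set of) a connected component of `G - S`:
a maximal subset of `V(G) - S` inducing a connected subgraph. -/
def IsCompOf (G : SimpleGraph V) (S R : Set V) : Prop :=
  R ⊆ Sᶜ ∧ (G.induce R).Connected ∧
    ∀ R' : Set V, R ⊆ R' → R' ⊆ Sᶜ → (G.induce R').Connected → R' = R

/-- The number of connected components of `G - S`. -/
noncomputable def numComp (G : SimpleGraph V) (S : Set V) : ℕ :=
  {R : Set V | IsCompOf G S R}.ncard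

/-- `S` is a cutset of `G` : the graph `G - S` is disconnected. -/
def IsCutset (G : SimpleGraph V) (S : Set V) : Prop := 2 ≤ numComp G S

/-- `G` is `t`-tough: for every cutset `S`, `t * c(G - S) ≤ |S|`. -/
def Tough (t : ℝ) (G : SimpleGraph V) : Prop :=
  ∀ S : Set V, IsCutset G S → t * (numComp G S : ℝ) ≤ (S.ncard : ℝ)

/-- `t` is the toughness of `G` : the largest `s` such that `G` is `s`-tough.
(For a complete graph no such largest `s` exists; the toughness is infinite.) -/
def IsToughness (G : SimpleGraph V) (t : ℝ) : Prop :=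
  Tough t G ∧ ∀ s : ℝ, Tough s G → s ≤ t

/-- `S` is a tough-set of `G` (whose toughness is `t`): a cutset with
`|S| = t * c(G - S)`. -/
def ToughSet (G : SimpleGraph V) (t : ℝ) (S : Set V) : Prop :=
  IsCutset G S ∧ (S.ncard : ℝ) = t * (numComp G S : ℝ)

/-- Vertex `u` is adjacent in `G` to some vertex of the set `R`. -/
def AdjToSet (G : SimpleGraph V) (u : V) (R : Set V) : Prop := ∃ v ∈ R, G.Adj u v

/-- `G` has a Hamiltonian cycle. -/
def HasHamCycle [DecidableEq V] (G : SimpleGraph V) : Prop :=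
  ∃ (v : V) (w : G.Walk v v), w.IsHamiltonianCycle

/-- `G` has a spanning `k`-walk: a closed walk visiting every vertex at least once
and at most `k` times.  (In a nontrivial closed walk the base vertex occurs one
extra time in `Walk.support`, whence the correction term.) -/
def HasSpanningKWalk [DecidableEq V] (G : SimpleGraph V) (k : ℕ) : Prop :=
  ∃ (v : V) (w : G.Walk v v), (∀ x : V, x ∈ w.support) ∧
    ∀ x : V, w.support.count x ≤ k + (if x = v then 1 else 0)

/-- The prism over `G`: the Cartesian (box) product `G □ K₂`. -/
def prism (G : SimpleGraph V) : SimpleGraph (V × Fin 2) :=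
  G.boxProd (⊤ : SimpleGraph (Fin 2))

/-- The graph obtained from `G` by contracting the set `R` to a single vertex
(namely `Sum.inr ()`), which is adjacent to exactly those vertices outside `R`
having a neighbor in `R`. -/
def contractSet (G : SimpleGraph V) (R : Set V) : SimpleGraph (↥(Rᶜ) ⊕ Unit) :=
  SimpleGraph.fromRel fun x y =>
    match x, y with
    | Sum.inl a, Sum.inl b => G.Adj ↑a ↑b
    | Sum.inl a, Sum.inr _ => ∃ r ∈ R, G.Adj ↑a r
    | _, _ => False

/-- `v` is a cutvertex of `H` : deleting `v` leaves a disconnected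
(non-preconnected) graph. -/
def IsCutvertex (H : SimpleGraph W) (v : W) : Prop :=
  ¬ (H.induce ({v}ᶜ : Set W)).Preconnected

/-- `B` is a block of `H` : a maximal connected subgraph having no cutvertex of
its own. -/
def IsBlock (H : SimpleGraph W) (B : H.Subgraph) : Prop :=
  B.coe.Connected ∧ (∀ v, ¬ IsCutvertex B.coe v) ∧
    ∀ B' : H.Subgraph, B ≤ B' → B'.coe.Connected →
      (∀ v, ¬ IsCutvertex B'.coe v) → B' = B

/-- `H` is a cycle of even length. -/
def IsEvenCycleGraph (H : SimpleGraph W) : Prop :=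
  ∃ n : ℕ, Even n ∧ 3 ≤ n ∧ Nonempty (H ≃g SimpleGraph.cycleGraph n)

/-- `H` is a single edge. -/
def IsSingleEdgeGraph (H : SimpleGraph W) : Prop :=
  ∃ u v : W, u ≠ v ∧ H.Adj u v ∧ ∀ w : W, w = u ∨ w = v

/-- `H` is a simple block EP (SBEP) graph: a connected graph in which every block
is an even cycle or a single edge, and every vertex lies in at most two blocks. -/
def IsSBEP (H : SimpleGraph W) : Prop :=
  H.Connected ∧
    (∀ B : H.Subgraph, IsBlock H B → IsEvenCycleGraph B.coe ∨ IsSingleEdgeGraph B.coe) ∧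
    ∀ (v : W) (B₁ B₂ B₃ : H.Subgraph),
      IsBlock H B₁ ∧ v ∈ B₁.verts → IsBlock H B₂ ∧ v ∈ B₂.verts →
      IsBlock H B₃ ∧ v ∈ B₃.verts → B₁ = B₂ ∨ B₁ = B₃ ∨ B₂ = B₃

/-- `v` is a single-block vertex of `H` : it lies in exactly one block. -/
def SingleBlockVertex (H : SimpleGraph W) (v : W) : Prop :=
  ∃! B : H.Subgraph, IsBlock H B ∧ v ∈ B.verts

namespace SimpleGraph

variable {G : SimpleGraph V} {S R T : Set V}

theorem Connected.eq_of_subset_of_adj_closed (hR : (G.induce R).Connected) (hTR : T ⊆ R)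
    (hne : T.Nonempty) (hcl : ∀ x ∈ T, ∀ y ∈ R, G.Adj x y → y ∈ T) : R = T := by
  refine Set.Subset.antisymm (fun y hy => ?_) hTR
  obtain ⟨x, hx⟩ := hne
  obtain ⟨w⟩ := hR.preconnected ⟨x, hTR hx⟩ ⟨y, hy⟩
  have key : ∀ (a b : R), (G.induce R).Walk a b → (a : V) ∈ T → (b : V) ∈ T := by
    intro a b w
    induction w with
    | nil => exact id
    | cons h _ ih => exact fun ha => ih (hcl _ ha _ (Subtype.prop _) h)
  exact key _ _ w hx

end SimpleGraph

namespace IsCompOf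

variable {G : SimpleGraph V} {S R R' T : Set V}

theorem nonempty (h : IsCompOf G S R) : R.Nonempty :=
  Set.nonempty_coe_sort.mp h.2.1.nonempty

theorem subset_of_connected (h : IsCompOf G S R) (hT : (G.induce T).Connected) (hTS : T ⊆ Sᶜ)
    (hRT : (R ∩ T).Nonempty) : T ⊆ R := by
  have := h.2.2 (R ∪ T) Set.subset_union_left (Set.union_subset h.1 hTS)
    (induce_union_connected h.2.1.preconnected hT.preconnected hRT)
  exact this ▸ Set.subset_union_right

theorem mem_of_adj (h : IsCompOf G S R) {x y : V} (hx : x ∈ R) (hy : y ∉ S) (hxy : G.Adj x y) :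
    y ∈ R := by
  refine h.subset_of_connected (induce_pair_connected_of_adj hxy) ?_ ⟨x, hx, by simp⟩ (by simp)
  rintro z (rfl | rfl)
  exacts [h.1 hx, hy]

theorem eq_of_mem (h : IsCompOf G S R) (h' : IsCompOf G S R') {x : V} (hx : x ∈ R)
    (hx' : x ∈ R') : R = R' :=
  Set.Subset.antisymm (h'.subset_of_connected h.2.1 h.1 ⟨x, hx', hx⟩)
    (h.subset_of_connected h'.2.1 h'.1 ⟨x, hx, hx'⟩)

theorem of_adj_closed (hTS : T ⊆ Sᶜ) (hT : (G.induce T).Connected)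
    (hcl : ∀ x ∈ T, ∀ y ∉ S, G.Adj x y → y ∈ T) : IsCompOf G S T :=
  ⟨hTS, hT, fun _ hTR hRS hR => hR.eq_of_subset_of_adj_closed hTR
    (Set.nonempty_coe_sort.mp hT.nonempty) fun x hx y hy => hcl x hx y (hRS hy)⟩

theorem exists_mem [Finite V] (G : SimpleGraph V) {x : V} (hx : x ∉ S) :
    ∃ R, IsCompOf G S R ∧ x ∈ R := by
  have hx' : {x} ∈ {T : Set V | T ⊆ Sᶜ ∧ (G.induce T).Connected} :=
    ⟨by simpa using hx, by simp⟩
  obtain ⟨R, hxR, hR⟩ := (Set.toFinite _).exists_le_maximal hx'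
  exact ⟨R, ⟨hR.prop.1, hR.prop.2, fun R' h h₁ h₂ => (hR.eq_of_subset ⟨h₁, h₂⟩ h).symm⟩,
    hxR rfl⟩

end IsCompOf

theorem IsCutset.exists_ne {G : SimpleGraph V} {S : Set V} (h : IsCutset G S) :
    ∃ R₁ R₂, IsCompOf G S R₁ ∧ IsCompOf G S R₂ ∧ R₁ ≠ R₂ := by
  obtain ⟨a, ha, b, hb, hab⟩ :=
    (Set.one_lt_ncard (Set.finite_of_ncard_pos (lt_of_lt_of_le two_pos h))).mp h
  exact ⟨a, b, ha, hb, hab⟩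

theorem P4Free.not_induced_path {G : SimpleGraph V} (h : P4Free G) {a b c d : V}
    (hab : G.Adj a b) (hbc : G.Adj b c) (hcd : G.Adj c d) (hac : ¬ G.Adj a c)
    (had : ¬ G.Adj a d) (hbd : ¬ G.Adj b d) : False := by
  have h1 : a ≠ c := by rintro rfl; exact had hcd
  have h2 : a ≠ d := by rintro rfl; exact hac hcd.symm
  have h3 : b ≠ d := by rintro rfl; exact had hab
  refine h.false ⟨⟨![a, b, c, d], ?_⟩, ?_⟩
  · intro i j
    fin_cases i <;> fin_cases j <;>
      simp [hab.ne, hbc.ne, hcd.ne, h1, h2, h3, hab.ne', hbc.ne', hcd.ne', h1.symm, h2.symm,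
        h3.symm]
  · intro i j
    change G.Adj (![a, b, c, d] i) (![a, b, c, d] j) ↔ _
    fin_cases i <;> fin_cases j <;>
      simp [pathGraph_adj, hab, hbc, hcd, hac, had, hbd, hab.symm, hbc.symm, hcd.symm,
        G.adj_comm c a, G.adj_comm d a, G.adj_comm d b]

/-- In a `P₄`-free graph, a vertex with neighbours in two components of `G - S` is complete or
anticomplete to each component. -/
theorem P4Free.adj_of_adj_of_two_components {G : SimpleGraph V} (h : P4Free G)
    {S R₁ R₂ : Set V} {u a b : V} (h₁ : IsCompOf G S R₁) (h₂ : IsCompOf G S R₂) (hne : R₁ ≠ R₂)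
    (hu₁ : AdjToSet G u R₁) (hu₂ : AdjToSet G u R₂) (ha : a ∉ S) (hb : b ∉ S)
    (hua : G.Adj u a) (hab : G.Adj a b) : G.Adj u b := by
  by_contra hub
  have key : ∀ R, IsCompOf G S R → AdjToSet G u R → a ∈ R := by
    rintro R hR ⟨w, hw, huw⟩
    by_contra haR
    have hbR : b ∉ R := fun hbR => haR (hR.mem_of_adj hbR ha hab.symm)
    exact h.not_induced_path hab.symm hua.symm huw (fun hbu => hub hbu.symm)
      (fun hbw => hbR (hR.mem_of_adj hw hb hbw.symm))
      (fun haw => haR (hR.mem_of_adj hw ha haw.symm))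
  exact hne (h₁.eq_of_mem h₂ (key _ h₁ hu₁) (key _ h₂ hu₂))

/-- In a connected `P₄`-free graph, if `S` is a non-minimal cutset
each vertex of which is adjacent to at least two components of `G - S`, then there are
a cutset `U ⊆ S`, nonempty `X ⊆ S - U` and nonempty `Y ⊆ V(G) - S` such that
`G[X ∪ Y]` is a component of `G - U` and `G[U, X, Y]` is complete tripartite. -/
theorem stmt_11 {V : Type*} [Fintype V] (G : SimpleGraph V) (hconn : G.Connected)
    (hP4 : P4Free G) (S : Set V) (hcut : IsCutset G S)
    (hadj : ∀ u ∈ S, ∃ R₁ R₂ : Set V, IsCompOf G S R₁ ∧ IsCompOf G S R₂ ∧ R₁ ≠ R₂ ∧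
      AdjToSet G u R₁ ∧ AdjToSet G u R₂)
    (hnotmin : ¬ ∀ S' : Set V, S' ⊂ S → ¬ IsCutset G S') :
    ∃ U X Y : Set V, U ⊆ S ∧ IsCutset G U ∧
      X ⊆ S \ U ∧ X.Nonempty ∧ Y ⊆ Sᶜ ∧ Y.Nonempty ∧
      IsCompOf G U (X ∪ Y) ∧
      (∀ u ∈ U, ∀ w ∈ X ∪ Y, G.Adj u w) ∧
      (∀ x ∈ X, ∀ y ∈ Y, G.Adj x y) := by
  set N : V → Set V := fun u => {y | y ∉ S ∧ G.Adj u y}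
  have hclosed : ∀ u ∈ S, ∀ a ∈ N u, ∀ b ∉ S, G.Adj a b → b ∈ N u := by
    rintro u hu a ⟨ha, hua⟩ b hb hab
    obtain ⟨R₁, R₂, h₁, h₂, hne, hu₁, hu₂⟩ := hadj u hu
    exact ⟨hb, hP4.adj_of_adj_of_two_components h₁ h₂ hne hu₁ hu₂ ha hb hua hab⟩
  have hNne : ∀ u ∈ S, (N u).Nonempty := by
    intro u hu
    obtain ⟨R₁, _, h₁, _, _, ⟨w, hw, huw⟩, _⟩ := hadj u hu
    exact ⟨w, h₁.1 hw, huw⟩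
  have hnadj : ∀ u ∈ S, ∀ a ∈ N u, ∀ b ∉ S, b ∉ N u → ¬ G.Adj a b :=
    fun u hu a ha b hb hbu hab => hbu (hclosed u hu a ha b hb hab)
  have hnested : ∀ u ∈ S, ∀ v ∈ S, N u ⊂ N v → G.Adj v u := by
    intro u hu v hv huv
    by_contra hvu
    obtain ⟨c, hc⟩ := hNne u hu
    obtain ⟨a, ha, hau⟩ := Set.exists_of_ssubset huv
    exact hP4.not_induced_path hc.2 (huv.1 hc).2.symm ha.2 (fun h => hvu h.symm)
      (fun h => hau ⟨ha.1, h⟩) (hnadj u hu c hc a ha.1 hau)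
  have hcross : ∀ u ∈ S, ∀ v ∈ S, ¬ N u ⊆ N v → ¬ N v ⊆ N u →
      ¬ G.Adj u v ∧ Disjoint (N u) (N v) := by
    intro u hu v hv huv hvu
    obtain ⟨a, ha, hav⟩ := Set.not_subset.mp huv
    obtain ⟨b, hb, hbu⟩ := Set.not_subset.mp hvu
    have hab := hnadj u hu a ha b hb.1 hbu
    have huv' : ¬ G.Adj u v := fun h => hP4.not_induced_path ha.2.symm h hb.2
      (fun h => hav ⟨ha.1, h.symm⟩) hab (fun h => hbu ⟨hb.1, h⟩)
    refine ⟨huv', Set.disjoint_left.mpr fun c hcu hcv => ?_⟩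
    exact hP4.not_induced_path ha.2.symm hcu.2 hcv.2.symm
      (fun h => hnadj v hv c hcv a ha.1 hav h.symm) (fun h => hav ⟨ha.1, h.symm⟩) huv'
  have hproper : ∃ u ∈ S, ¬ Sᶜ ⊆ N u := by
    by_contra! hall
    push Not at hnotmin
    obtain ⟨S', hS', hcut'⟩ := hnotmin
    obtain ⟨u, hu, hu'⟩ := Set.exists_of_ssubset hS'
    obtain ⟨y, hy, -⟩ := hNne u hu
    have key : ∀ R, IsCompOf G S' R → u ∈ R := by
      intro R hR
      have hout : ∀ x ∈ R, x ∉ S → u ∈ R := fun x hx hxS =>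
        hR.mem_of_adj hx hu' (hall u hu hxS).2.symm
      obtain ⟨x, hx⟩ := hR.nonempty
      by_cases hxS : x ∈ S
      · exact hout y (hR.mem_of_adj hx (fun h => hy (hS'.1 h)) (hall x hxS hy).2) hy
      · exact hout x hx hxS
    obtain ⟨R₁, R₂, h₁, h₂, hne⟩ := hcut'.exists_ne
    exact hne (h₁.eq_of_mem h₂ (key _ h₁) (key _ h₂))
  obtain ⟨u₀, hu₀, hu₀N⟩ := hproper
  obtain ⟨_, hle, ⟨⟨u, hu, rfl⟩, hmin⟩⟩ :=
    (Set.toFinite (N '' S)).exists_le_minimal (Set.mem_image_of_mem N hu₀)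
  have hminimal : ∀ v ∈ S, N v ⊆ N u → N v = N u := fun v hv h =>
    Set.Subset.antisymm h (hmin (Set.mem_image_of_mem N hv) h)
  obtain ⟨z, hzS, hzu⟩ := Set.not_subset.mp fun h => hu₀N (h.trans hle)
  have htri : ∀ v ∈ S, ¬ N u ⊂ N v → N v ≠ N u → ¬ G.Adj u v ∧ Disjoint (N u) (N v) := by
    intro v hv hss hne
    refine hcross u hu v hv (fun h => hss ⟨h, fun h' => hne (hminimal v hv h')⟩)
      (fun h => hne (hminimal v hv h))
  obtain ⟨y₀, hy₀⟩ := hNne u hu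
  set U : Set V := {v | v ∈ S ∧ N u ⊂ N v}
  set X : Set V := {v | v ∈ S ∧ N v = N u}
  have hXadj : ∀ x ∈ X, ∀ y ∈ N u, G.Adj x y := fun x hx y hy => (hx.2.symm ▸ hy : y ∈ N x).2
  have huX : u ∈ X := ⟨hu, rfl⟩
  have hUc : X ∪ N u ⊆ Uᶜ := by
    rintro w (hw | hw) hwU
    · exact hwU.2.ne hw.2.symm
    · exact hw.1 hwU.1
  have hconnXY : (G.induce (X ∪ N u)).Connected := by
    have hreach : ∀ w : ↥(X ∪ N u), (G.induce (X ∪ N u)).Reachable w ⟨y₀, Or.inr hy₀⟩ := by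
      have hX' : ∀ x (hx : x ∈ X), (G.induce (X ∪ N u)).Reachable ⟨x, Or.inl hx⟩
          ⟨y₀, Or.inr hy₀⟩ := fun x hx => Adj.reachable (induce_adj.mpr (hXadj x hx y₀ hy₀))
      rintro ⟨w, hw | hw⟩
      · exact hX' w hw
      · exact Reachable.trans (v := ⟨u, Or.inl huX⟩) (Adj.reachable (induce_adj.mpr hw.2.symm)) (hX' u huX)
    exact (connected_iff _).mpr
      ⟨fun a b => (hreach a).trans (hreach b).symm, ⟨⟨u, Or.inl huX⟩⟩⟩
  have hcomp : IsCompOf G U (X ∪ N u) := by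
    refine IsCompOf.of_adj_closed hUc hconnXY fun x hx y hyU hxy => ?_
    by_cases hyS : y ∈ S
    · by_contra hy
      have hyne : N y ≠ N u := fun h => hy (Or.inl ⟨hyS, h⟩)
      have hyss : ¬ N u ⊂ N y := fun h => hyU ⟨hyS, h⟩
      obtain hx | hx := hx
      · refine (hcross x hx.1 y hyS ?_ ?_).1 hxy <;> rw [hx.2]
        · exact fun h => hyss ⟨h, fun h' => hyne (hminimal y hyS h')⟩
        · exact fun h => hyne (hminimal y hyS h)
      · exact Set.disjoint_left.mp (htri y hyS hyss hyne).2 hx ⟨hx.1, hxy.symm⟩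
    · obtain hx | hx := hx
      · exact Or.inr (hx.2 ▸ ⟨hyS, hxy⟩)
      · exact Or.inr (hclosed u hu x hx y hyS hxy)
  refine ⟨U, X, N u, fun v hv => hv.1, ?_, fun v hv => ⟨hv.1, fun h => hUc (Or.inl hv) h⟩,
    ⟨u, huX⟩, fun y hy => hy.1, ⟨y₀, hy₀⟩, hcomp, ?_, hXadj⟩
  · obtain ⟨R, hR, hzR⟩ := IsCompOf.exists_mem G (S := U) (fun h => hzS h.1)
    refine (Set.one_lt_ncard (Set.toFinite _)).mpr ⟨_, hcomp, R, hR, ?_⟩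
    rintro rfl
    exact hzR.elim (fun h => hzS h.1) hzu
  · rintro v hv w (hw | hw)
    · exact hnested w hw.1 v hv.1 (hw.2.symm ▸ hv.2)
    · exact (hv.2.1 hw).2
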